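/- For every a ∈ (0, 1) there exists a C² (indeed smooth) function u : ℝ → ℝ with the following properties, where m = a/2 - a³/6 and r₋ < r₊ denote the two positive roots of f_m(r) = 1 - r²/3 - 2m/r: (i) u(s) > 0 for all s and u satisfies u''(s) = (1 - u'(s)²)/(2u(s)) - u(s)/2 on all of ℝ; (ii) u(0) = a and u'(0) = 0; (iii) u is periodic with period T = 2∫_{r₋}^{r₊} f_m(ρ)^{-1/2} dρ; (iv) a ≤ u(s) ≤ r₊ for all s, with u(0) = a = min u and u(T/2) = r₊ = max u; (v) u is strictly increasing on [0, T/2]. -/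

import Mathlib

open MeasureTheory Set Real

/-- The inverse of the primitive of a smooth positive even `2π`-periodic function: a smooth
increasing reparametrization of the line solving `θ' = 1 / w(θ)`. -/
theorem exists_orderIso_hasDerivAt_inv {w : ℝ → ℝ} (hw : ContDiff ℝ (⊤ : ℕ∞) w)
    (hpos : ∀ x, 0 < w x) (hper : Function.Periodic w (2 * π)) (heven : ∀ x, w (-x) = w x) :
    ∃ θ : ℝ ≃o ℝ, ContDiff ℝ (⊤ : ℕ∞) θ ∧ (∀ s, HasDerivAt θ (w (θ s))⁻¹ s) ∧ θ 0 = 0 ∧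
      θ (∫ x in (0 : ℝ)..π, w x) = π ∧
      ∀ s, θ (s + 2 * ∫ x in (0 : ℝ)..π, w x) = θ s + 2 * π := by
  have hcont : Continuous w := hw.continuous
  have hint : ∀ b c, IntervalIntegrable w volume b c := fun b c => hcont.intervalIntegrable b c
  let S : ℝ → ℝ := fun t => ∫ x in (0 : ℝ)..t, w x
  have hS : ∀ t, HasDerivAt S (w t) t := fun t => hcont.integral_hasStrictDerivAt 0 t |>.hasDerivAt
  have hSderiv : deriv S = w := funext fun t => (hS t).deriv
  have hSsmooth : ContDiff ℝ (⊤ : ℕ∞) S :=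
    contDiff_infty_iff_deriv.2 ⟨fun t => (hS t).differentiableAt, hSderiv ▸ hw⟩
  have hSmono : StrictMono S := strictMono_of_deriv_pos fun t => hSderiv ▸ hpos t
  have hSsurj : Function.Surjective S :=
    hSsmooth.continuous.surjective
      (hper.tendsto_atTop_intervalIntegral_of_pos' (hint _ _) hpos two_pi_pos)
      (hper.tendsto_atBot_intervalIntegral_of_pos' (hint _ _) hpos two_pi_pos)
  let e : ℝ ≃o ℝ := hSmono.orderIsoOfSurjective S hSsurj
  have he : ∀ t, e.symm (S t) = t := fun t => e.symm_apply_apply t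
  have hSe : ∀ s, S (e.symm s) = s := fun s => e.apply_symm_apply s
  have hperiod : (∫ x in (0 : ℝ)..2 * π, w x) = 2 * ∫ x in (0 : ℝ)..π, w x := by
    have h₁ := hper.intervalIntegral_add_eq (-π) 0
    have h₂ : (∫ x in (-π)..0, w x) = ∫ x in (0 : ℝ)..π, w x := by
      have := intervalIntegral.integral_comp_neg (a := 0) (b := π) w
      simpa [heven] using this.symm
    have h₃ := intervalIntegral.integral_add_adjacent_intervals (hint (-π) 0) (hint 0 π)
    rw [show -π + 2 * π = π by ring, zero_add] at h₁
    linarith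
  refine ⟨e.symm, ?_, fun s => ?_, ?_, he π, fun s => ?_⟩
  · exact e.toHomeomorph.contDiff_symm_deriv (fun t => (hpos t).ne') hS hSsmooth
  · exact (hS _).of_local_left_inverse e.symm.continuous.continuousAt (hpos _).ne'
      (Filter.Eventually.of_forall hSe)
  · simpa [S] using he 0
  · have : S (e.symm s + 2 * π) = s + 2 * ∫ x in (0 : ℝ)..π, w x := by
      have h₁ := hper.intervalIntegral_add_eq (e.symm s) 0
      have h₂ := intervalIntegral.integral_add_adjacent_intervals (hint 0 (e.symm s))
        (hint (e.symm s) (e.symm s + 2 * π))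
      have h₃ := hSe s
      rw [zero_add, hperiod] at h₁
      simp only [S] at h₃ ⊢
      linarith
    rw [← this, he]

/-- The substitution `ρ = c - d cos x` in an integral over `[c - d, c + d]`. -/
theorem integral_eq_integral_comp_sub_mul_cos {c d : ℝ} (hd : 0 < d) (g : ℝ → ℝ) :
    (∫ ρ in (c - d)..(c + d), g ρ) = ∫ x in (0 : ℝ)..π, d * sin x * g (c - d * cos x) := by
  have himage : (fun x => c - d * cos x) '' Ioo 0 π = Ioo (c - d) (c + d) := by
    ext y
    constructor
    · rintro ⟨x, ⟨hx₀, hx₁⟩, rfl⟩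
      have h₁ := cos_lt_cos_of_nonneg_of_le_pi le_rfl hx₁.le hx₀
      have h₂ := cos_lt_cos_of_nonneg_of_le_pi hx₀.le le_rfl hx₁
      rw [cos_zero] at h₁
      rw [cos_pi] at h₂
      constructor <;> nlinarith
    · rintro ⟨hy₀, hy₁⟩
      have h₁ : -1 < (c - y) / d := by rw [lt_div_iff₀ hd]; linarith
      have h₂ : (c - y) / d < 1 := by rw [div_lt_iff₀ hd]; linarith
      refine ⟨arccos ((c - y) / d), ⟨arccos_pos.2 h₂, arccos_lt_pi.2 h₁⟩, ?_⟩
      simp only [cos_arccos h₁.le h₂.le]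
      field_simp
      ring
  have hinj : InjOn (fun x => c - d * cos x) (Ioo 0 π) := fun x hx y hy hxy =>
    injOn_cos (Ioo_subset_Icc_self hx) (Ioo_subset_Icc_self hy)
      (mul_left_cancel₀ hd.ne' (sub_right_injective hxy))
  have hderiv : ∀ x ∈ Ioo (0 : ℝ) π,
      HasDerivWithinAt (fun x => c - d * cos x) (d * sin x) (Ioo 0 π) x := fun x _ => by
    simpa using (((hasDerivAt_cos x).const_mul d).const_sub c).hasDerivWithinAt
  rw [intervalIntegral.integral_of_le (by linarith), intervalIntegral.integral_of_le pi_pos.le,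
    integral_Ioc_eq_integral_Ioo, integral_Ioc_eq_integral_Ioo, ← himage,
    integral_image_eq_integral_abs_deriv_smul measurableSet_Ioo hderiv hinj]
  refine setIntegral_congr_fun measurableSet_Ioo fun x hx => ?_
  simp only [smul_eq_mul]
  rw [abs_of_pos (mul_pos hd (sin_pos_of_mem_Ioo hx))]

/-- Periodic solutions of the profile equation, with minimum `c - d` and maximum `c + d`. -/
theorem exists_periodic_profile {c d : ℝ} (hd : 0 < d) (hdc : d < c)
    (hcd : 3 * c ^ 2 + d ^ 2 = 3) :
    ∃ (u : ℝ → ℝ) (L : ℝ),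
      (L = ∫ x in (0 : ℝ)..π, √(3 * (c - d * cos x) / (3 * c - d * cos x))) ∧
      ContDiff ℝ (⊤ : ℕ∞) u ∧
      (∀ s, deriv (deriv u) s = (1 - (deriv u s) ^ 2) / (2 * u s) - u s / 2) ∧
      u 0 = c - d ∧ deriv u 0 = 0 ∧ Function.Periodic u (2 * L) ∧
      (∀ s, c - d ≤ u s ∧ u s ≤ c + d) ∧ u L = c + d ∧ StrictMonoOn u (Icc 0 L) := by
  have hr : ∀ x, 0 < c - d * cos x := fun x => by nlinarith [cos_le_one x]
  have hq : ∀ x, 0 < 3 * c - d * cos x := fun x => by linarith [hr x]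
  have hh : ∀ x, 0 < 3 * (c - d * cos x) / (3 * c - d * cos x) := fun x =>
    div_pos (mul_pos three_pos (hr x)) (hq x)
  let w : ℝ → ℝ := fun x => √(3 * (c - d * cos x) / (3 * c - d * cos x))
  have hwpos : ∀ x, 0 < w x := fun x => sqrt_pos.2 (hh x)
  have hwsq : ∀ x, w x ^ 2 = 3 * (c - d * cos x) / (3 * c - d * cos x) := fun x =>
    sq_sqrt (hh x).le
  have hw : ContDiff ℝ (⊤ : ℕ∞) w :=
    ContDiff.sqrt (ContDiff.div (by fun_prop) (by fun_prop) fun x => (hq x).ne')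
      fun x => (hh x).ne'
  obtain ⟨θ, hθ, hθ', hθ₀, hθL, hθT⟩ := exists_orderIso_hasDerivAt_inv hw hwpos
    (fun x => by simp [w]) (fun x => by simp [w])
  have hw' : ∀ x, HasDerivAt w (3 * c * (d * sin x) / ((3 * c - d * cos x) ^ 2 * w x)) x :=
    fun x => by
    have hcos := (hasDerivAt_cos x).const_mul d
    have hdiv := ((hcos.const_sub c).const_mul 3).div (hcos.const_sub (3 * c)) (hq x).ne'
    refine (hdiv.sqrt (hh x).ne').congr_deriv ?_
    have h₁ := (hq x).ne'
    have h₂ := (hwpos x).ne'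
    change _ / (2 * w x) = _
    field_simp
    ring
  have hu' : ∀ s, HasDerivAt (fun s => c - d * cos (θ s)) (d * sin (θ s) * (w (θ s))⁻¹) s :=
    fun s => by
    refine (((hθ' s).cos.const_mul d).const_sub c).congr_deriv ?_
    ring
  have hderiv : deriv (fun s => c - d * cos (θ s)) = fun s => d * sin (θ s) * (w (θ s))⁻¹ :=
    funext fun s => (hu' s).deriv
  refine ⟨fun s => c - d * cos (θ s), _, rfl, by fun_prop, fun s => ?_, ?_, ?_, fun s => ?_,
    fun s => ?_, ?_, ?_⟩
  · rw [hderiv]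
    have h₀ := (hwpos (θ s)).ne'
    have hwθ : HasDerivAt (fun s => w (θ s)) _ s := (hw' (θ s)).comp s (hθ' s)
    rw [(((hθ' s).sin.const_mul d).fun_mul (hwθ.fun_inv h₀)).deriv]
    beta_reduce
    have h₁ := (hq (θ s)).ne'
    have h₂ := (hr (θ s)).ne'
    have h₃ := hwsq (θ s)
    have h₄ := sin_sq (θ s)
    generalize w (θ s) = W at *
    generalize sin (θ s) = y at *
    generalize cos (θ s) = z at *
    have h₅ : W⁻¹ ^ 2 = (3 * c - d * z) / (3 * (c - d * z)) := by
      rw [inv_pow, h₃, inv_div]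
    trans d * z * W⁻¹ ^ 2 - 3 * c * d ^ 2 * y ^ 2 / (3 * c - d * z) ^ 2 * (W⁻¹ ^ 2) ^ 2
    · field_simp
      ring
    trans (1 - d ^ 2 * y ^ 2 * W⁻¹ ^ 2) / (2 * (c - d * z)) - (c - d * z) / 2
    · rw [h₅, h₄]
      field_simp
      linear_combination (c - d * z) * hcd
    · ring
  · simp [hθ₀]
  · simp [hderiv, hθ₀]
  · simp only [w] at hθT
    simp only [hθT, cos_add_two_pi]
  · constructor <;> nlinarith [cos_le_one (θ s), neg_one_le_cos (θ s)]
  · simp only [w] at hθL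
    simp [hθL]
  · intro s hs t ht hst
    have h₁ : 0 ≤ θ s := hθ₀ ▸ θ.monotone hs.1
    have h₂ : θ t ≤ π := (θ.monotone ht.2).trans_eq hθL
    have := cos_lt_cos_of_nonneg_of_le_pi h₁ h₂ (θ.strictMono hst)
    simp only
    nlinarith

/-- For every a ∈ (0,1) there is a smooth positive periodic solution u of
u'' = (1-(u')²)/(2u) - u/2 on ℝ with u(0) = a = min u, u'(0) = 0, maximum r₊ attained at
T/2, period T = 2∫_{r₋}^{r₊} f_m(ρ)^{-1/2} dρ, and u strictly increasing on [0, T/2],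
where m = a/2 - a³/6 and r₋ < r₊ are the two positive roots of f_m. -/
theorem stmt_8 (a : ℝ) (ha0 : 0 < a) (ha1 : a < 1)
    (m : ℝ) (hm : m = a/2 - a^3/6)
    (rm rp : ℝ) (hrm : 0 < rm) (hlt : rm < rp)
    (hrm0 : 1 - rm^2/3 - 2*m/rm = 0) (hrp0 : 1 - rp^2/3 - 2*m/rp = 0)
    (honly : ∀ r : ℝ, 0 < r → 1 - r^2/3 - 2*m/r = 0 → r = rm ∨ r = rp) :
    ∃ u : ℝ → ℝ, ContDiff ℝ (⊤ : ℕ∞) u ∧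
      (∀ s, 0 < u s) ∧
      (∀ s, deriv (deriv u) s = (1 - (deriv u s)^2)/(2 * u s) - u s / 2) ∧
      u 0 = a ∧ deriv u 0 = 0 ∧
      Function.Periodic u (2 * ∫ ρ in rm..rp, (Real.sqrt (1 - ρ^2/3 - 2*m/ρ))⁻¹) ∧
      (∀ s, a ≤ u s ∧ u s ≤ rp) ∧
      u ((2 * ∫ ρ in rm..rp, (Real.sqrt (1 - ρ^2/3 - 2*m/ρ))⁻¹) / 2) = rp ∧
      StrictMonoOn u
        (Set.Icc 0 ((2 * ∫ ρ in rm..rp, (Real.sqrt (1 - ρ^2/3 - 2*m/ρ))⁻¹) / 2)) := by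
  have hrp : 0 < rp := hrm.trans hlt
  have hmm : 6 * m = 3 * rm - rm ^ 3 := by
    field_simp at hrm0
    linarith
  have hmp : 6 * m = 3 * rp - rp ^ 3 := by
    field_simp at hrp0
    linarith
  have hroots : rm ^ 2 + rm * rp + rp ^ 2 = 3 :=
    mul_left_cancel₀ (sub_pos.2 hlt).ne' (by linear_combination hmp - hmm)
  have ha : a = rm := by
    refine (honly a ha0 (by subst hm; field_simp; ring)).resolve_right ?_
    rintro rfl
    nlinarith
  obtain ⟨c, d, rfl, rfl⟩ : ∃ c d, rm = c - d ∧ rp = c + d :=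
    ⟨(rm + rp) / 2, (rp - rm) / 2, by ring, by ring⟩
  have hd : 0 < d := by linarith
  have hdc : d < c := by linarith
  obtain ⟨u, L, hL, hsmooth, hode, hu₀, hu₀', hper, hbd, huL, hmono⟩ :=
    exists_periodic_profile hd hdc (by linear_combination hroots)
  have hLeq : (∫ ρ in (c - d)..(c + d), (√(1 - ρ ^ 2 / 3 - 2 * m / ρ))⁻¹) = L := by
    rw [hL, integral_eq_integral_comp_sub_mul_cos hd, intervalIntegral.integral_of_le pi_pos.le,
      intervalIntegral.integral_of_le pi_pos.le, integral_Ioc_eq_integral_Ioo,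
      integral_Ioc_eq_integral_Ioo]
    refine setIntegral_congr_fun measurableSet_Ioo fun x hx => ?_
    have hds : 0 < d * sin x := mul_pos hd (sin_pos_of_mem_Ioo hx)
    have hr : 0 < c - d * cos x := by nlinarith [cos_le_one x]
    have hq : 0 < 3 * c - d * cos x := by linarith
    have hf : 1 - (c - d * cos x) ^ 2 / 3 - 2 * m / (c - d * cos x) =
        (d * sin x) ^ 2 * (3 * (c - d * cos x) / (3 * c - d * cos x))⁻¹ := by
      have h₁ := sin_sq x
      rw [mul_pow, h₁, inv_div]
      field_simp
      linear_combination (d * cos x - d) * hroots - hmm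
    simp only [hf]
    rw [sqrt_mul (sq_nonneg _), sqrt_sq hds.le, sqrt_inv, mul_inv, inv_inv,
      mul_inv_cancel_left₀ hds.ne']
  rw [hLeq, mul_div_cancel_left₀ L two_ne_zero, ha]
  exact ⟨u, hsmooth, fun s => hrm.trans_le (hbd s).1, hode, hu₀, hu₀', hper, hbd, huL, hmono⟩
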